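/- Data-processing inequality for pinching: let ρ and σ be density matrices on ℂ^d with σ positive definite, and let A be a Hermitian d×d matrix such that σ commutes with every spectral projection of A (equivalently ℰ_A(σ) = σ). Then for every α ∈ (−1/2, 0) ∪ (0, ∞): D̃_{1+α}(ℰ_A(ρ) ‖ σ) ≤ D̃_{1+α}(ρ ‖ σ), where ℰ_A(ρ) is again a density matrix. -/

import Mathlib

open Matrix BigOperators
open scoped ComplexOrder

noncomputable section

variable {n : Type*} [Fintype n] [DecidableEq n]

/-- Real power with the convention `0 ^ r = 0`. -/
def rpow0 (x r : ℝ) : ℝ := if x = 0 then 0 else Real.rpow x r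

/-- Matrix power by the spectral functional calculus (with `0 ^ r = 0` on the kernel),
for Hermitian matrices; junk value `0` otherwise. -/
def matPow (M : Matrix n n ℂ) (r : ℝ) : Matrix n n ℂ :=
  if h : M.IsHermitian then
    (h.eigenvectorUnitary : Matrix n n ℂ) *
      Matrix.diagonal (fun i => (rpow0 (h.eigenvalues i) r : ℂ)) *
      star (h.eigenvectorUnitary : Matrix n n ℂ)
  else 0

/-- A density matrix: positive semidefinite with unit trace. -/
def IsDensityMatrix (M : Matrix n n ℂ) : Prop := M.PosSemidef ∧ M.trace = 1

/-- Number of distinct eigenvalues of a Hermitian matrix (junk value `0` otherwise). -/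
def nEig (M : Matrix n n ℂ) : ℕ :=
  if h : M.IsHermitian then (Finset.univ.image h.eigenvalues).card else 0

/-- The spectral projection of a Hermitian matrix onto the eigenspace of `t`. -/
def spectralProj (M : Matrix n n ℂ) (h : M.IsHermitian) (t : ℝ) : Matrix n n ℂ :=
  (h.eigenvectorUnitary : Matrix n n ℂ) *
    Matrix.diagonal (fun i => if h.eigenvalues i = t then (1 : ℂ) else 0) *
    star (h.eigenvectorUnitary : Matrix n n ℂ)

/-- The pinching map with respect to a Hermitian matrix `A`:
`ℰ_A(B) = ∑_λ P_λ B P_λ` over the distinct eigenvalues `λ` of `A`. -/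
def pinch (A B : Matrix n n ℂ) : Matrix n n ℂ :=
  if h : A.IsHermitian then
    ∑ t ∈ Finset.univ.image h.eigenvalues,
      spectralProj A h t * B * spectralProj A h t
  else B

/-- The spectral projection of a Hermitian matrix onto its nonnegative eigenvalues,
`Π = ∑_{λ ≥ 0} P_λ` (junk value `0` for non-Hermitian matrices). -/
def posProj (M : Matrix n n ℂ) : Matrix n n ℂ :=
  if h : M.IsHermitian then
    (h.eigenvectorUnitary : Matrix n n ℂ) *
      Matrix.diagonal (fun i => if 0 ≤ h.eigenvalues i then (1 : ℂ) else 0) *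
      star (h.eigenvectorUnitary : Matrix n n ℂ)
  else 0

/-- The sandwiched Rényi divergence
`D̃_α(ρ‖σ) = (1/(α−1)) log₂ Tr[(σ^{(1−α)/(2α)} ρ σ^{(1−α)/(2α)})^α]`. -/
def sandwichedRenyi (α : ℝ) (ρ σ : Matrix n n ℂ) : ℝ :=
  (1 / (α - 1)) *
    Real.logb 2
      ((matPow (matPow σ ((1 - α) / (2 * α)) * ρ * matPow σ ((1 - α) / (2 * α))) α).trace.re)

/-- Fidelity `F(ρ,σ) = Tr[(σ^{1/2} ρ σ^{1/2})^{1/2}]`. -/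
def fidelity (ρ σ : Matrix n n ℂ) : ℝ :=
  (matPow (matPow σ (1/2) * ρ * matPow σ (1/2)) (1/2)).trace.re

/-- Purified distance `P(ρ,σ) = √(1 − F(ρ,σ)²)`. -/
def purifiedDist (ρ σ : Matrix n n ℂ) : ℝ :=
  Real.sqrt (1 - (fidelity ρ σ) ^ 2)

/-- Base-two matrix logarithm by spectral functional calculus (`0 ↦ 0` on the kernel). -/
def matLog2 (M : Matrix n n ℂ) : Matrix n n ℂ :=
  if h : M.IsHermitian then
    (h.eigenvectorUnitary : Matrix n n ℂ) *
      Matrix.diagonal (fun i => (Real.logb 2 (h.eigenvalues i) : ℂ)) *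
      star (h.eigenvectorUnitary : Matrix n n ℂ)
  else 0

/-- Quantum relative entropy `D(ρ‖σ) = Tr[ρ (log₂ ρ − log₂ σ)]`. -/
def relEntropy (ρ σ : Matrix n n ℂ) : ℝ :=
  (ρ * (matLog2 ρ - matLog2 σ)).trace.re


end

section

variable {n : Type*} [Fintype n] [DecidableEq n]

theorem matPow_eq_cfc {M : Matrix n n ℂ} (h : M.IsHermitian) (r : ℝ) :
    matPow M r = cfc (fun x : ℝ => rpow0 x r) M := by
  rw [h.cfc_eq, matPow, dif_pos h, IsHermitian.cfc, Unitary.conjStarAlgAut_apply]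
  rfl

theorem spectralProj_eq_cfc {M : Matrix n n ℂ} (h : M.IsHermitian) (t : ℝ) :
    spectralProj M h t = cfc (fun x : ℝ => if x = t then (1 : ℝ) else 0) M := by
  rw [h.cfc_eq, spectralProj, IsHermitian.cfc, Unitary.conjStarAlgAut_apply]
  congr 3
  ext i
  simp [Function.comp]

theorem continuousOn_real_spectrum (M : Matrix n n ℂ) (f : ℝ → ℝ) :
    ContinuousOn f (spectrum ℝ M) :=
  M.finite_real_spectrum.continuousOn f

theorem isHermitian_spectralProj {A : Matrix n n ℂ} (h : A.IsHermitian) (t : ℝ) :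
    (spectralProj A h t).IsHermitian := by
  rw [spectralProj_eq_cfc]
  exact cfc_predicate (R := ℝ) _ A

theorem spectralProj_mul_spectralProj {A : Matrix n n ℂ} (h : A.IsHermitian) (s t : ℝ) :
    spectralProj A h s * spectralProj A h t = if s = t then spectralProj A h t else 0 := by
  simp only [spectralProj_eq_cfc]
  rw [← cfc_mul _ _ A (continuousOn_real_spectrum A _) (continuousOn_real_spectrum A _)]
  split_ifs with hst
  · subst hst
    congr 1
    ext x
    simp
  · rw [← cfc_zero ℝ A]
    congr 1
    ext x
    simp only [Pi.zero_apply]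
    grind

theorem sum_spectralProj {A : Matrix n n ℂ} (h : A.IsHermitian) :
    ∑ t ∈ Finset.univ.image h.eigenvalues, spectralProj A h t = 1 := by
  simp only [spectralProj_eq_cfc]
  rw [← cfc_sum _ _ _ (fun _ _ => continuousOn_real_spectrum A _),
    ← cfc_const_one ℝ A h.isSelfAdjoint]
  refine cfc_congr fun x hx => ?_
  rw [h.spectrum_real_eq_range_eigenvalues] at hx
  obtain ⟨i, rfl⟩ := hx
  simp [Finset.sum_apply]

theorem commute_spectralProj_of_pinch_eq {A B : Matrix n n ℂ} (h : A.IsHermitian)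
    (hB : pinch A B = B) {t : ℝ} (ht : t ∈ Finset.univ.image h.eigenvalues) :
    Commute B (spectralProj A h t) := by
  have hl : spectralProj A h t * pinch A B = spectralProj A h t * B * spectralProj A h t := by
    rw [pinch, dif_pos h, Finset.mul_sum, Finset.sum_eq_single_of_mem t ht]
    · rw [← mul_assoc, ← mul_assoc, spectralProj_mul_spectralProj, if_pos rfl]
    · intro s _ hs
      rw [← mul_assoc, ← mul_assoc, spectralProj_mul_spectralProj, if_neg hs.symm, zero_mul,
        zero_mul]
  have hr : pinch A B * spectralProj A h t = spectralProj A h t * B * spectralProj A h t := by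
    rw [pinch, dif_pos h, Finset.sum_mul, Finset.sum_eq_single_of_mem t ht]
    · rw [mul_assoc, spectralProj_mul_spectralProj, if_pos rfl]
    · intro s _ hs
      rw [mul_assoc, spectralProj_mul_spectralProj, if_neg hs, mul_zero]
  rw [hB] at hl hr
  exact hr.trans hl.symm

theorem pinch_conj {A K B : Matrix n n ℂ} (h : A.IsHermitian)
    (hK : ∀ t ∈ Finset.univ.image h.eigenvalues, Commute K (spectralProj A h t)) :
    pinch A (K * B * K) = K * pinch A B * K := by
  simp only [pinch, dif_pos h, Finset.mul_sum, Finset.sum_mul]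
  refine Finset.sum_congr rfl fun t ht => ?_
  have := (hK t ht).eq
  calc spectralProj A h t * (K * B * K) * spectralProj A h t
      = (spectralProj A h t * K) * B * (K * spectralProj A h t) := by simp only [mul_assoc]
    _ = (K * spectralProj A h t) * B * (spectralProj A h t * K) := by rw [this]
    _ = _ := by simp only [mul_assoc]

theorem Matrix.PosSemidef.pinch {A B : Matrix n n ℂ} (hB : B.PosSemidef) :
    (pinch A B).PosSemidef := by
  unfold _root_.pinch
  split_ifs with h
  · refine Matrix.posSemidef_sum _ fun t _ => ?_
    have := hB.conjTranspose_mul_mul_same (spectralProj A h t)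
    rwa [(isHermitian_spectralProj h t).eq] at this
  · exact hB

theorem trace_pinch (A B : Matrix n n ℂ) : (pinch A B).trace = B.trace := by
  unfold pinch
  split_ifs with h
  · calc _ = ∑ t ∈ Finset.univ.image h.eigenvalues, (spectralProj A h t * B).trace := by
          rw [trace_sum]
          refine Finset.sum_congr rfl fun t _ => ?_
          rw [trace_mul_comm, ← mul_assoc, spectralProj_mul_spectralProj, if_pos rfl]
      _ = _ := by rw [← trace_sum, ← Finset.sum_mul, sum_spectralProj, one_mul]
  · rfl

theorem trace_matPow {M : Matrix n n ℂ} (h : M.IsHermitian) {r : ℝ} (hr : r ≠ 0) :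
    (matPow M r).trace.re = ∑ i, h.eigenvalues i ^ r := by
  have hrpow : ∀ x : ℝ, rpow0 x r = x ^ r := fun x => by
    unfold rpow0
    split_ifs with hx
    · rw [hx, Real.zero_rpow hr]
    · rfl
  rw [matPow, dif_pos h, trace_mul_cycle, Unitary.coe_star_mul_self, one_mul, trace_diagonal,
    Complex.re_sum]
  simp [hrpow]

theorem matPow_mul_matPow_neg {σ : Matrix n n ℂ} (hσ : σ.PosDef) (s : ℝ) :
    matPow σ s * matPow σ (-s) = 1 := by
  have h := hσ.isHermitian
  rw [matPow_eq_cfc h, matPow_eq_cfc h,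
    ← cfc_mul _ _ σ (continuousOn_real_spectrum σ _) (continuousOn_real_spectrum σ _),
    ← cfc_const_one ℝ σ h.isSelfAdjoint]
  refine cfc_congr fun x hx => ?_
  rw [h.spectrum_real_eq_range_eigenvalues] at hx
  obtain ⟨i, rfl⟩ := hx
  have hi := hσ.eigenvalues_pos i
  simp only [rpow0, if_neg hi.ne', Real.rpow_eq_pow]
  rw [← Real.rpow_add hi, add_neg_cancel, Real.rpow_zero]

/-- The eigenvalues of a pinched matrix arise from those of the matrix through a doubly
stochastic matrix. -/
theorem exists_doublyStochastic_eigenvalues_pinch {A M : Matrix n n ℂ} (hA : A.IsHermitian)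
    (hM : M.IsHermitian) (hP : (pinch A M).IsHermitian) :
    ∃ S ∈ doublyStochastic ℝ n, hP.eigenvalues = S *ᵥ hM.eigenvalues := by
  set U := (hM.eigenvectorUnitary : Matrix n n ℂ)
  set W := (hP.eigenvectorUnitary : Matrix n n ℂ)
  set T := Finset.univ.image hA.eigenvalues
  let X : ℝ → Matrix n n ℂ := fun t => star W * spectralProj A hA t * U
  have hUU : U * star U = 1 := Unitary.coe_mul_star_self _
  have hUU' : star U * U = 1 := Unitary.coe_star_mul_self _
  have hWW : W * star W = 1 := Unitary.coe_mul_star_self _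
  have hWW' : star W * W = 1 := Unitary.coe_star_mul_self _
  have hXs : ∀ t, star (X t) = star U * spectralProj A hA t * W := fun t => by
    have : star (spectralProj A hA t) = spectralProj A hA t := isHermitian_spectralProj hA t
    simp only [X, star_mul, star_star, this, mul_assoc]
  have hrow : ∑ t ∈ T, X t * star (X t) = 1 := by
    have : ∀ t ∈ T, X t * star (X t) = star W * spectralProj A hA t * W := fun t _ => by
      calc X t * star (X t)
          = star W * spectralProj A hA t * (U * star U) * spectralProj A hA t * W := by
            rw [hXs]; simp only [X, mul_assoc]
        _ = star W * (spectralProj A hA t * spectralProj A hA t) * W := by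
            rw [hUU]; simp only [mul_assoc, one_mul]
        _ = _ := by rw [spectralProj_mul_spectralProj, if_pos rfl]
    rw [Finset.sum_congr rfl this, ← Finset.sum_mul, ← Finset.mul_sum, sum_spectralProj, mul_one,
      hWW']
  have hcol : ∑ t ∈ T, star (X t) * X t = 1 := by
    have : ∀ t ∈ T, star (X t) * X t = star U * spectralProj A hA t * U := fun t _ => by
      calc star (X t) * X t
          = star U * spectralProj A hA t * (W * star W) * spectralProj A hA t * U := by
            rw [hXs]; simp only [X, mul_assoc]
        _ = star U * (spectralProj A hA t * spectralProj A hA t) * U := by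
            rw [hWW]; simp only [mul_assoc, one_mul]
        _ = _ := by rw [spectralProj_mul_spectralProj, if_pos rfl]
    rw [Finset.sum_congr rfl this, ← Finset.sum_mul, ← Finset.mul_sum, sum_spectralProj, mul_one,
      hUU']
  have hMd : M = U * diagonal (fun i => (hM.eigenvalues i : ℂ)) * star U := by
    conv_lhs => rw [hM.spectral_theorem, Unitary.conjStarAlgAut_apply]
    rfl
  have hPd : pinch A M = W * diagonal (fun i => (hP.eigenvalues i : ℂ)) * star W := by
    conv_lhs => rw [hP.spectral_theorem, Unitary.conjStarAlgAut_apply]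
    rfl
  have hdiag : diagonal (fun i => (hP.eigenvalues i : ℂ)) =
      ∑ t ∈ T, X t * diagonal (fun i => (hM.eigenvalues i : ℂ)) * star (X t) := by
    calc diagonal (fun i => (hP.eigenvalues i : ℂ))
        = (star W * W) * diagonal (fun i => (hP.eigenvalues i : ℂ)) * (star W * W) := by
          rw [hWW', one_mul, mul_one]
      _ = star W * pinch A M * W := by
          refine Eq.trans ?_ (congrArg (fun B => star W * B * W) hPd).symm
          simp only [mul_assoc]
      _ = ∑ t ∈ T, star W * (spectralProj A hA t * M * spectralProj A hA t) * W := by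
          rw [pinch, dif_pos hA, Finset.mul_sum, Finset.sum_mul]
      _ = _ := by
          refine Finset.sum_congr rfl fun t _ => ?_
          conv_lhs => rw [hMd]
          rw [hXs]; simp only [X, mul_assoc]
  refine ⟨Matrix.of fun i j => ∑ t ∈ T, Complex.normSq (X t i j), ?_, ?_⟩
  · rw [mem_doublyStochastic_iff_sum]
    refine ⟨fun i j => Finset.sum_nonneg fun t _ => Complex.normSq_nonneg _, fun i => ?_,
      fun j => ?_⟩
    · have := congrFun (congrFun hrow i) i
      simp only [Matrix.sum_apply, Matrix.mul_apply, star_apply, one_apply_eq,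
        Complex.star_def, Complex.mul_conj] at this
      rw [Finset.sum_comm] at this
      exact_mod_cast this
    · have := congrFun (congrFun hcol j) j
      simp only [Matrix.sum_apply, Matrix.mul_apply, star_apply, one_apply_eq,
        Complex.star_def, ← Complex.normSq_eq_conj_mul_self] at this
      rw [Finset.sum_comm] at this
      exact_mod_cast this
  · ext i
    have := congrFun (congrFun hdiag i) i
    have hent : ∀ t, (X t * diagonal (fun i => (hM.eigenvalues i : ℂ)) * star (X t)) i i =
        ∑ j, (Complex.normSq (X t i j) : ℂ) * hM.eigenvalues j := fun t => by
      rw [Matrix.mul_apply]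
      refine Finset.sum_congr rfl fun j _ => ?_
      rw [mul_diagonal, star_apply, Complex.star_def, mul_right_comm, Complex.mul_conj]
    simp only [diagonal_apply_eq, Matrix.sum_apply, hent] at this
    rw [Finset.sum_comm] at this
    simp only [mulVec, dotProduct, of_apply, Finset.sum_mul]
    exact_mod_cast this

theorem ConvexOn.sum_mulVec_le {s : Set ℝ} {f : ℝ → ℝ} (hf : ConvexOn ℝ s f) {S : Matrix n n ℝ}
    (hS : S ∈ doublyStochastic ℝ n) {v : n → ℝ} (hv : ∀ i, v i ∈ s) :
    ∑ i, f ((S *ᵥ v) i) ≤ ∑ i, f (v i) := by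
  rw [mem_doublyStochastic_iff_sum] at hS
  obtain ⟨h0, hr, hc⟩ := hS
  calc ∑ i, f ((S *ᵥ v) i) ≤ ∑ i, ∑ j, S i j * f (v j) := by
        refine Finset.sum_le_sum fun i _ => ?_
        exact hf.map_sum_le (fun j _ => h0 i j) (hr i) (fun j _ => hv j)
    _ = ∑ j, f (v j) := by
        rw [Finset.sum_comm]
        exact Finset.sum_congr rfl fun j _ => by rw [← Finset.sum_mul, hc, one_mul]

theorem trace_matPow_pinch_le {A M : Matrix n n ℂ} (hA : A.IsHermitian) (hM : M.PosSemidef)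
    {p : ℝ} (hp : 1 ≤ p) :
    (matPow (pinch A M) p).trace.re ≤ (matPow M p).trace.re := by
  have hP : (pinch A M).PosSemidef := hM.pinch
  obtain ⟨S, hS, heq⟩ := exists_doublyStochastic_eigenvalues_pinch hA hM.isHermitian hP.isHermitian
  have hp0 : p ≠ 0 := by linarith
  rw [trace_matPow hM.isHermitian hp0, trace_matPow hP.isHermitian hp0, heq]
  exact (convexOn_rpow hp).sum_mulVec_le hS hM.eigenvalues_nonneg

theorem trace_matPow_le_pinch {A M : Matrix n n ℂ} (hA : A.IsHermitian) (hM : M.PosSemidef)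
    {p : ℝ} (hp0 : 0 < p) (hp1 : p ≤ 1) :
    (matPow M p).trace.re ≤ (matPow (pinch A M) p).trace.re := by
  have hP : (pinch A M).PosSemidef := hM.pinch
  obtain ⟨S, hS, heq⟩ := exists_doublyStochastic_eigenvalues_pinch hA hM.isHermitian hP.isHermitian
  rw [trace_matPow hM.isHermitian hp0.ne', trace_matPow hP.isHermitian hp0.ne', heq]
  have := (Real.concaveOn_rpow hp0.le hp1).neg.sum_mulVec_le hS hM.eigenvalues_nonneg
  simpa only [Pi.neg_apply, Finset.sum_neg_distrib, neg_le_neg_iff] using this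

theorem trace_matPow_pos {M : Matrix n n ℂ} (hM : M.PosSemidef) (h0 : M.trace ≠ 0) {p : ℝ}
    (hp : p ≠ 0) : 0 < (matPow M p).trace.re := by
  rw [trace_matPow hM.isHermitian hp]
  obtain ⟨i, -, hi⟩ : ∃ i ∈ Finset.univ, (hM.isHermitian.eigenvalues i : ℂ) ≠ 0 := by
    apply Finset.exists_ne_zero_of_sum_ne_zero
    rwa [hM.isHermitian.trace_eq_sum_eigenvalues] at h0
  have hpos : 0 < hM.isHermitian.eigenvalues i :=
    (hM.eigenvalues_nonneg i).lt_of_ne' (by exact_mod_cast hi)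
  exact Finset.sum_pos' (fun j _ => Real.rpow_nonneg (hM.eigenvalues_nonneg j) p)
    ⟨i, Finset.mem_univ i, Real.rpow_pos_of_pos hpos p⟩

end

/-- STATEMENT 14: data-processing inequality for pinching: if `σ` is invariant under the
pinching map of `A`, then `D̃_{1+α}(ℰ_A(ρ)‖σ) ≤ D̃_{1+α}(ρ‖σ)` for `α ∈ (−1/2,0) ∪ (0,∞)`. -/
theorem pinching_data_processing
    {n : Type*} [Fintype n] [DecidableEq n]
    (ρ σ A : Matrix n n ℂ) (hρ : IsDensityMatrix ρ) (hσ : IsDensityMatrix σ)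
    (hσpd : σ.PosDef) (hA : A.IsHermitian) (hcomm : pinch A σ = σ)
    (α : ℝ) (hα : α ∈ Set.Ioo (-(1/2) : ℝ) 0 ∪ Set.Ioi (0 : ℝ)) :
    sandwichedRenyi (1 + α) (pinch A ρ) σ ≤ sandwichedRenyi (1 + α) ρ σ := by
  set s := (1 - (1 + α)) / (2 * (1 + α)) with hs
  set K := matPow σ s with hK
  have hKcfc := matPow_eq_cfc hσpd.isHermitian s
  have hKherm : K.IsHermitian := by
    rw [hK, hKcfc]
    exact cfc_predicate (R := ℝ) _ σ
  have hM : (K * ρ * K).PosSemidef := by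
    have := hρ.1.conjTranspose_mul_mul_same K
    rwa [hKherm.eq] at this
  have hpinch : K * pinch A ρ * K = pinch A (K * ρ * K) :=
    (pinch_conj hA fun t ht => by
      rw [hK, hKcfc]
      exact (commute_spectralProj_of_pinch_eq hA hcomm ht).cfc_real _).symm
  have htr : (K * ρ * K).trace ≠ 0 := by
    intro h0
    have hz := hM.trace_eq_zero_iff.1 h0
    have h1 : K * matPow σ (-s) = 1 := matPow_mul_matPow_neg hσpd s
    have h2 : matPow σ (-s) * K = 1 := mul_eq_one_comm.1 h1
    have hρ0 : ρ = 0 := by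
      calc ρ = (matPow σ (-s) * K) * ρ * (K * matPow σ (-s)) := by rw [h1, h2, one_mul, mul_one]
        _ = matPow σ (-s) * (K * ρ * K) * matPow σ (-s) := by simp only [mul_assoc]
        _ = 0 := by rw [hz, mul_zero, zero_mul]
    have := hρ.2
    simp [hρ0] at this
  have htr' : (pinch A (K * ρ * K)).trace ≠ 0 := by rwa [trace_pinch]
  have hp0 : 0 < 1 + α := by
    rcases hα with hα | hα
    · linarith [hα.1]
    · linarith [Set.mem_Ioi.1 hα]
  unfold sandwichedRenyi
  rw [← hs, ← hK, hpinch, add_sub_cancel_left]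
  rcases hα with hα | hα
  · have hneg : 1 / α ≤ 0 := one_div_nonpos.2 hα.2.le
    exact mul_le_mul_of_nonpos_left
      (Real.logb_le_logb_of_le one_lt_two (trace_matPow_pos hM htr hp0.ne')
        (trace_matPow_le_pinch hA hM hp0 (by linarith [hα.2]))) hneg
  · have hpos : 0 < α := hα
    exact mul_le_mul_of_nonneg_left
      (Real.logb_le_logb_of_le one_lt_two (trace_matPow_pos hM.pinch htr' hp0.ne')
        (trace_matPow_pinch_le hA hM (by linarith))) (one_div_pos.2 hpos).le
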